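/- Let (X, Σ) be a measurable space, n ∈ ℕ, a₁,…,aₙ ∈ [0,1] with Σ_{k=1}^n a_k = 1, and let μ₁,…,μₙ be probability measures on (X,Σ). Then for every family Q ⊆ Σ, H(Σ_{k=1}^n a_k μ_k; Q) ≤ Σ_{k=1}^n a_k H(μ_k;Q) + log₂(n). -/

import Mathlib

open MeasureTheory ENNReal

/-- The Shannon function `sh(x) = -x·log₂ x` (with `sh 0 = 0`). -/
noncomputable def sh (x : ℝ) : ℝ := -(x * Real.logb 2 x)

/-- `P` is a `μ`-partition of `X`: a countable family of pairwise disjoint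
measurable sets covering `X` up to a `μ`-null set. -/
def IsMuPartition {X : Type*} [MeasurableSpace X] (μ : Measure X) (P : Set (Set X)) : Prop :=
  P.Countable ∧ (∀ s ∈ P, MeasurableSet s) ∧ P.Pairwise Disjoint ∧ μ (⋃₀ P)ᶜ = 0

/-- The `μ`-entropy `h(μ;P) = Σ_{P∈P} sh(μ(P))` of a family of sets. -/
noncomputable def partEntropy {X : Type*} [MeasurableSpace X] (μ : Measure X)
    (P : Set (Set X)) : ℝ≥0∞ :=
  ∑' s : P, ENNReal.ofReal (sh (μ s).toReal)

/-- `P ≺ Q` : every element of `P` is contained in some element of `Q`. -/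
def Finer {X : Type*} (P Q : Set (Set X)) : Prop := ∀ p ∈ P, ∃ q ∈ Q, p ⊆ q

/-- The (classical) `μ`-entropy of a family `Q`:
`H(μ;Q) = inf { h(μ;P) : P a μ-partition, P ≺ Q }`, with `inf ∅ = ∞`. -/
noncomputable def entropyH {X : Type*} [MeasurableSpace X] (μ : Measure X)
    (Q : Set (Set X)) : ℝ≥0∞ :=
  ⨅ (P : Set (Set X)) (_ : IsMuPartition μ P) (_ : Finer P Q), partEntropy μ P

/-- `m ∈ V(μ;Q)` : a weighting of `Q`, i.e. `m : Q → Measure X` with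
`m_Q(X \ Q) = 0` for all `Q ∈ Q` and `Σ_{Q∈Q} m_Q = μ`. -/
def IsWeighting {X : Type*} [MeasurableSpace X] (μ : Measure X) (Q : Set (Set X))
    (m : Q → Measure X) : Prop :=
  (∀ q : Q, m q ((q : Set X))ᶜ = 0) ∧ Measure.sum m = μ

/-- The weighted `μ`-entropy of `m ∈ V(μ;Q)` : `hv(μ;m) = Σ_{Q∈Q} sh(m_Q(X))`. -/
noncomputable def wEntropy {X : Type*} [MeasurableSpace X] (Q : Set (Set X))
    (m : Q → Measure X) : ℝ≥0∞ :=
  ∑' q : Q, ENNReal.ofReal (sh ((m q) Set.univ).toReal)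

/-- The weighted `μ`-entropy of `Q` : `Hv(μ;Q) = inf { hv(μ;m) : m ∈ V(μ;Q) }`,
with `inf ∅ = ∞`. -/
noncomputable def entropyHv {X : Type*} [MeasurableSpace X] (μ : Measure X)
    (Q : Set (Set X)) : ℝ≥0∞ :=
  ⨅ (m : Q → Measure X) (_ : IsWeighting μ Q m), wEntropy Q m

/-- The family of all closed balls of radius `δ`. -/
def ballFam (X : Type*) [PseudoMetricSpace X] (δ : ℝ) : Set (Set X) :=
  Set.range (fun x : X => Metric.closedBall x δ)

/-- The lower entropy dimension `liminf_{δ→0⁺} H(μ;B_δ)/(-log₂ δ)`. -/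
noncomputable def ldimE {X : Type*} [PseudoMetricSpace X] [MeasurableSpace X]
    (μ : Measure X) : ℝ≥0∞ :=
  Filter.liminf (fun δ : ℝ => entropyH μ (ballFam X δ) / ENNReal.ofReal (-Real.logb 2 δ))
    (nhdsWithin 0 (Set.Ioi 0))

/-- The upper entropy dimension `limsup_{δ→0⁺} H(μ;B_δ)/(-log₂ δ)`. -/
noncomputable def udimE {X : Type*} [PseudoMetricSpace X] [MeasurableSpace X]
    (μ : Measure X) : ℝ≥0∞ :=
  Filter.limsup (fun δ : ℝ => entropyH μ (ballFam X δ) / ENNReal.ofReal (-Real.logb 2 δ))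
    (nhdsWithin 0 (Set.Ioi 0))

/-- `N_δ(S)` : the smallest number of closed balls of radius `δ` needed to cover `S`. -/
noncomputable def coverNum {X : Type*} [PseudoMetricSpace X] (S : Set X) (δ : ℝ) : ℝ≥0∞ :=
  ⨅ (t : Finset X) (_ : S ⊆ ⋃ x ∈ t, Metric.closedBall x δ), (t.card : ℝ≥0∞)

/-- The natural logarithm on `ℝ≥0∞` (with `log ∞ = ∞`), truncated to `ℝ≥0∞`. -/
noncomputable def logENN (x : ℝ≥0∞) : ℝ≥0∞ :=
  if x = ⊤ then ⊤ else ENNReal.ofReal (Real.log x.toReal)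

/-- The upper box dimension `limsup_{δ→0⁺} log N_δ(S)/(-log δ)`. -/
noncomputable def ubdimB {X : Type*} [PseudoMetricSpace X] (S : Set X) : ℝ≥0∞ :=
  Filter.limsup (fun δ : ℝ => logENN (coverNum S δ) / ENNReal.ofReal (-Real.log δ))
    (nhdsWithin 0 (Set.Ioi 0))

/-- The upper local dimension `D̄_μ(x) = limsup_{δ→0⁺} log μ(B(x,δ))/log δ`
(interpreted as `∞` when `μ(B(x,δ)) = 0`). -/
noncomputable def upLocalDim {X : Type*} [PseudoMetricSpace X] [MeasurableSpace X]
    (μ : Measure X) (x : X) : ℝ≥0∞ :=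
  Filter.limsup
    (fun δ : ℝ => if μ (Metric.closedBall x δ) = 0 then ⊤ else
      ENNReal.ofReal (Real.log (μ (Metric.closedBall x δ)).toReal / Real.log δ))
    (nhdsWithin 0 (Set.Ioi 0))

/-- Pointwise form of Gibbs' inequality. -/
lemma sh_add_div_log_two_le {b m : ℝ} (hb : 0 ≤ b) (hm : 0 < m) :
    sh b + b / Real.log 2 ≤ b * (-Real.logb 2 m) + m / Real.log 2 := by
  have h2 : 0 < Real.log 2 := Real.log_pos one_lt_two
  have key : -(b * Real.log b) + b ≤ b * -Real.log m + m := by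
    rcases hb.eq_or_lt with rfl | hb
    · simpa using hm.le
    · have h := mul_le_mul_of_nonneg_left (Real.log_le_sub_one_of_pos (div_pos hm hb)) hb.le
      rw [Real.log_div hm.ne' hb.ne', mul_sub, mul_sub, mul_div_cancel₀ _ hb.ne'] at h
      linarith
  have h := div_le_div_of_nonneg_right key h2.le
  calc sh b + b / Real.log 2 = (-(b * Real.log b) + b) / Real.log 2 := by
        simp only [sh, Real.logb]; ring
    _ ≤ (b * -Real.log m + m) / Real.log 2 := h
    _ = _ := by simp only [Real.logb]; ring

lemma sh_nonneg {x : ℝ} (h0 : 0 ≤ x) (h1 : x ≤ 1) : 0 ≤ sh x := by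
  have := Real.logb_nonpos one_lt_two h0 h1
  unfold sh
  nlinarith

lemma sh_mul (x y : ℝ) : sh (x * y) = x * sh y + y * sh x := by
  rcases eq_or_ne x 0 with rfl | hx
  · simp [sh]
  rcases eq_or_ne y 0 with rfl | hy
  · simp [sh]
  simp only [sh, Real.logb_mul hx hy]
  ring

/-- Gibbs' inequality for countable probability vectors. -/
lemma tsum_sh_le_tsum_mul_neg_logb {ι : Type*} {b m : ι → ℝ≥0∞}
    (hb : ∑' i, b i = 1) (hm : ∑' i, m i = 1) (hpos : ∀ i, m i ≠ 0) :
    ∑' i, ENNReal.ofReal (sh (b i).toReal) ≤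
      ∑' i, b i * ENNReal.ofReal (-Real.logb 2 (m i).toReal) := by
  have hb1 (i : ι) : b i ≤ 1 := hb ▸ ENNReal.le_tsum i
  have hm1 (i : ι) : m i ≤ 1 := hm ▸ ENNReal.le_tsum i
  have hbt (i : ι) : b i ≠ ⊤ := ne_top_of_le_ne_top one_ne_top (hb1 i)
  have hmt (i : ι) : m i ≠ ⊤ := ne_top_of_le_ne_top one_ne_top (hm1 i)
  have h2 : 0 < Real.log 2 := Real.log_pos one_lt_two
  have hpt (i : ι) : ENNReal.ofReal (sh (b i).toReal) + b i * ENNReal.ofReal (1 / Real.log 2) ≤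
      b i * ENNReal.ofReal (-Real.logb 2 (m i).toReal) +
        m i * ENNReal.ofReal (1 / Real.log 2) := by
    have hmR : 0 < (m i).toReal := ENNReal.toReal_pos (hpos i) (hmt i)
    have hbR1 : (b i).toReal ≤ 1 := ENNReal.toReal_le_of_le_ofReal zero_le_one (by simpa using hb1 i)
    have hmR1 : (m i).toReal ≤ 1 := ENNReal.toReal_le_of_le_ofReal zero_le_one (by simpa using hm1 i)
    have hlog : 0 ≤ -Real.logb 2 (m i).toReal :=
      neg_nonneg.2 (Real.logb_nonpos one_lt_two hmR.le hmR1)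
    have hbm := sh_add_div_log_two_le (b := (b i).toReal) ENNReal.toReal_nonneg hmR
    have hb0 : 0 ≤ (b i).toReal := ENNReal.toReal_nonneg
    have hi : 0 ≤ 1 / Real.log 2 := by positivity
    rw [← ENNReal.ofReal_toReal (hbt i), ← ENNReal.ofReal_toReal (hmt i),
      ENNReal.toReal_ofReal hb0, ENNReal.toReal_ofReal hmR.le,
      ← ENNReal.ofReal_mul hb0, ← ENNReal.ofReal_mul hb0, ← ENNReal.ofReal_mul hmR.le,
      ← ENNReal.ofReal_add (sh_nonneg hb0 hbR1) (by positivity),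
      ← ENNReal.ofReal_add (by positivity) (by positivity)]
    apply ENNReal.ofReal_le_ofReal
    simpa [div_eq_mul_inv] using hbm
  have h := ENNReal.tsum_le_tsum hpt
  rw [ENNReal.tsum_add, ENNReal.tsum_add, ENNReal.tsum_mul_right (f := b),
    ENNReal.tsum_mul_right (f := m), hb, hm] at h
  exact (ENNReal.add_le_add_iff_right (by simp)).1 h

/-- The entropy of a family of sets is at most the sum over any indexing of it. -/
lemma partEntropy_range_le {X ι : Type*} [MeasurableSpace X] (μ : Measure X) (B : ι → Set X) :
    partEntropy μ (Set.range B) ≤ ∑' i, ENNReal.ofReal (sh (μ (B i)).toReal) := by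
  refine le_trans (le_of_eq ?_) (ENNReal.tsum_comp_le_tsum_of_injective
    (Set.rangeSplitting_injective B) (fun i => ENNReal.ofReal (sh (μ (B i)).toReal)))
  exact tsum_congr fun s => by rw [Set.apply_rangeSplitting B s]

/-- A countable family of nonzero weights can be disjointified so that every set only loses points
to sets of at least the same weight, and the union is kept. -/
lemma exists_disjoint_of_weights {X ι : Type*} [MeasurableSpace X] [Countable ι]
    {A : ι → Set X} (hA : ∀ i, MeasurableSet (A i)) {w : ι → ℝ≥0∞}
    (hw : ∑' i, w i ≠ ⊤) (hpos : ∀ i, w i ≠ 0) :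
    ∃ B : ι → Set X, (∀ i, MeasurableSet (B i)) ∧ (∀ i, B i ⊆ A i) ∧
      Pairwise (Function.onFun Disjoint B) ∧ ⋃ i, B i = ⋃ i, A i ∧
      ∀ i j, (B i ∩ A j).Nonempty → w j ≤ w i := by
  obtain ⟨e, he⟩ := exists_injective_nat ι
  let key : ι → ℝ≥0∞ᵒᵈ ×ₗ ℕ := fun i => toLex (OrderDual.toDual (w i), e i)
  have key_inj : Function.Injective key := fun i j h => he (congrArg (fun p => (ofLex p).2) h)
  have key_le {i j : ι} (h : key i ≤ key j) : w j ≤ w i := by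
    rcases Prod.Lex.le_iff.1 h with h | h
    · exact (OrderDual.toDual_lt_toDual.1 h).le
    · exact (OrderDual.toDual.injective h.1).ge
  refine ⟨fun i => A i \ ⋃ j ∈ {j | key j < key i}, A j,
    fun i => (hA i).diff (MeasurableSet.biUnion (Set.to_countable _) fun j _ => hA j),
    fun i => Set.sdiff_subset, ?_, ?_, ?_⟩
  · intro i j hij
    refine Set.disjoint_left.2 fun x hi hj => ?_
    rcases lt_or_gt_of_ne (key_inj.ne hij) with h | h
    · exact hj.2 (Set.mem_biUnion h hi.1)
    · exact hi.2 (Set.mem_biUnion h hj.1)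
  · refine (Set.iUnion_mono fun i => Set.sdiff_subset).antisymm fun x hx => ?_
    obtain ⟨i, hi⟩ := Set.mem_iUnion.1 hx
    have hfin : {j | w i ≤ w j ∧ x ∈ A j}.Finite :=
      (ENNReal.finite_const_le_of_tsum_ne_top hw (hpos i)).subset fun j hj => hj.1
    obtain ⟨k, hk, hmin⟩ := Set.exists_min_image _ key hfin ⟨i, le_rfl, hi⟩
    refine Set.mem_iUnion.2 ⟨k, hk.2, fun hx' => ?_⟩
    obtain ⟨j, hj, hxj⟩ := Set.mem_iUnion₂.1 hx'
    exact (hmin j ⟨hk.1.trans (key_le (le_of_lt hj)), hxj⟩).not_gt hj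
  · rintro i j ⟨x, hx, hxj⟩
    exact key_le (not_lt.1 fun h => hx.2 (Set.mem_biUnion h hxj))

/-- A decomposition of a probability measure into nonzero measures carried by the sets `A i` can be
replaced by a partition into subsets of the `A i` without increasing the entropy. -/
lemma exists_isMuPartition_of_sum_eq_of_ne_zero {X ι : Type*} [MeasurableSpace X] [Countable ι]
    {μ : Measure X} [IsProbabilityMeasure μ] {A : ι → Set X} (hA : ∀ i, MeasurableSet (A i))
    {m : ι → Measure X} (hm : ∀ i, m i (A i)ᶜ = 0) (hsum : Measure.sum m = μ)
    (hpos : ∀ i, m i Set.univ ≠ 0) :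
    ∃ P, IsMuPartition μ P ∧ Finer P (Set.range A) ∧
      partEntropy μ P ≤ ∑' i, ENNReal.ofReal (sh (m i Set.univ).toReal) := by
  have hm1 : ∑' i, m i Set.univ = 1 := by
    rw [← Measure.sum_apply _ MeasurableSet.univ, hsum, measure_univ]
  have hle (i : ι) : m i Set.univ ≤ 1 := hm1 ▸ ENNReal.le_tsum i
  obtain ⟨B, hB, hBA, hdisj, hU, hw⟩ :=
    exists_disjoint_of_weights hA (w := fun i => m i Set.univ) (by simp [hm1]) hpos
  have hcover : μ (⋃ i, B i)ᶜ = 0 := by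
    rw [hU, ← hsum, Measure.sum_apply _ (MeasurableSet.iUnion hA).compl, ENNReal.tsum_eq_zero]
    exact fun i => measure_mono_null (Set.compl_subset_compl.2 (Set.subset_iUnion A i)) (hm i)
  have hb1 : ∑' i, μ (B i) = 1 := by
    rw [← measure_iUnion hdisj hB]
    exact (prob_compl_eq_zero_iff (MeasurableSet.iUnion hB)).1 hcover
  refine ⟨Set.range B, ⟨Set.countable_range B, ?_, ?_, ?_⟩, ?_, ?_⟩
  · rintro _ ⟨i, rfl⟩
    exact hB i
  · rintro _ ⟨i, rfl⟩ _ ⟨j, rfl⟩ hij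
    exact hdisj fun h => hij (congrArg B h)
  · rwa [Set.sUnion_range]
  · rintro _ ⟨i, rfl⟩
    exact ⟨A i, ⟨i, rfl⟩, hBA i⟩
  · let c : ι → ℝ≥0∞ := fun i => ENNReal.ofReal (-Real.logb 2 (m i Set.univ).toReal)
    have hc (j i : ι) : m j (B i) * c i ≤ m j (B i) * c j := by
      rcases eq_or_ne (m j (B i)) 0 with h | h
      · simp [h]
      have hne : (B i ∩ A j).Nonempty := by
        rw [Set.nonempty_iff_ne_empty]
        intro h0
        exact h (measure_mono_null
          (Set.disjoint_iff_inter_eq_empty.2 h0).subset_compl_right (hm j))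
      gcongr
      refine ENNReal.ofReal_le_ofReal (neg_le_neg ?_)
      refine Real.logb_le_logb_of_le one_lt_two
        (ENNReal.toReal_pos (hpos j) (ne_top_of_le_ne_top one_ne_top (hle j))) ?_
      exact ENNReal.toReal_mono (ne_top_of_le_ne_top one_ne_top (hle i)) (hw i j hne)
    calc partEntropy μ (Set.range B)
        ≤ ∑' i, ENNReal.ofReal (sh (μ (B i)).toReal) := partEntropy_range_le μ B
      _ ≤ ∑' i, μ (B i) * c i := tsum_sh_le_tsum_mul_neg_logb hb1 hm1 hpos
      _ = ∑' i, ∑' j, m j (B i) * c i := by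
        refine tsum_congr fun i => ?_
        rw [← hsum, Measure.sum_apply _ (hB i), ENNReal.tsum_mul_right]
      _ = ∑' j, ∑' i, m j (B i) * c i := ENNReal.tsum_comm
      _ ≤ ∑' j, ∑' i, m j (B i) * c j :=
        ENNReal.tsum_le_tsum fun j => ENNReal.tsum_le_tsum fun i => hc j i
      _ ≤ ∑' j, m j Set.univ * c j := by
        refine ENNReal.tsum_le_tsum fun j => ?_
        rw [ENNReal.tsum_mul_right, ← measure_iUnion hdisj hB]
        gcongr
        exact Set.subset_univ _
      _ = ∑' i, ENNReal.ofReal (sh (m i Set.univ).toReal) := by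
        refine tsum_congr fun i => ?_
        have hmt : m i Set.univ ≠ ⊤ := ne_top_of_le_ne_top one_ne_top (hle i)
        nth_rw 1 [← ENNReal.ofReal_toReal hmt]
        rw [← ENNReal.ofReal_mul ENNReal.toReal_nonneg, sh, mul_neg]

/-- A decomposition of a probability measure into measures carried by the sets `A i` can be
replaced by a partition into subsets of the `A i` without increasing the entropy. -/
lemma exists_isMuPartition_of_sum_eq {X ι : Type*} [MeasurableSpace X] [Countable ι]
    {μ : Measure X} [IsProbabilityMeasure μ] {A : ι → Set X} (hA : ∀ i, MeasurableSet (A i))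
    {m : ι → Measure X} (hm : ∀ i, m i (A i)ᶜ = 0) (hsum : Measure.sum m = μ) :
    ∃ P, IsMuPartition μ P ∧ Finer P (Set.range A) ∧
      partEntropy μ P ≤ ∑' i, ENNReal.ofReal (sh (m i Set.univ).toReal) := by
  let J : Set ι := {i | m i Set.univ ≠ 0}
  have hsumJ : Measure.sum (fun i : J => m i) = μ := by
    ext s hs
    rw [← hsum, Measure.sum_apply _ hs, Measure.sum_apply _ hs]
    refine tsum_subtype_eq_of_support_subset (f := fun i => m i s) fun i hi h0 => hi ?_
    exact measure_mono_null (Set.subset_univ s) h0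
  obtain ⟨P, hP, hfin, hent⟩ := exists_isMuPartition_of_sum_eq_of_ne_zero
    (A := fun i : J => A i) (fun i => hA i) (fun i => hm i) hsumJ (fun i => i.2)
  refine ⟨P, hP, fun p hp => ?_, hent.trans
    (ENNReal.tsum_comp_le_tsum_of_injective Subtype.val_injective _)⟩
  obtain ⟨_, ⟨i, rfl⟩, hi⟩ := hfin p hp
  exact ⟨A i, ⟨i, rfl⟩, hi⟩

/-- The entropy of a finite probability vector is at most the logarithm of its length. -/
lemma sum_sh_le_logb {n : ℕ} {a : Fin n → ℝ} (ha : ∀ k, 0 ≤ a k) (hsum : ∑ k, a k = 1) :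
    ∑ k, sh (a k) ≤ Real.logb 2 n := by
  have hn : 0 < n := by
    rcases Nat.eq_zero_or_pos n with rfl | h
    · simp at hsum
    · exact h
  have hn' : (0 : ℝ) < n := Nat.cast_pos.2 hn
  have h := Finset.sum_le_sum fun k (_ : k ∈ Finset.univ) =>
    sh_add_div_log_two_le (ha k) (inv_pos.2 hn')
  rw [Finset.sum_add_distrib, Finset.sum_add_distrib, ← Finset.sum_div, ← Finset.sum_mul, hsum,
    Finset.sum_const, Finset.card_univ, Fintype.card_fin, nsmul_eq_mul, Real.logb_inv,
    mul_div_assoc', mul_inv_cancel₀ hn'.ne'] at h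
  linarith

lemma ofReal_sh_mul {x : ℝ} (hx : x ∈ Set.Icc (0 : ℝ) 1) {y : ℝ≥0∞} (hy : y ≤ 1) :
    ENNReal.ofReal (sh (ENNReal.ofReal x * y).toReal) =
      ENNReal.ofReal x * ENNReal.ofReal (sh y.toReal) + y * ENNReal.ofReal (sh x) := by
  have hyR : y.toReal ≤ 1 := ENNReal.toReal_le_of_le_ofReal zero_le_one (by simpa using hy)
  have hy0 : 0 ≤ y.toReal := ENNReal.toReal_nonneg
  have hsx := sh_nonneg hx.1 hx.2
  have hsy := sh_nonneg hy0 hyR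
  rw [ENNReal.toReal_mul, ENNReal.toReal_ofReal hx.1, sh_mul,
    ENNReal.ofReal_add (mul_nonneg hx.1 hsy) (mul_nonneg hy0 hsx), ENNReal.ofReal_mul hx.1,
    ENNReal.ofReal_mul hy0, ENNReal.ofReal_toReal (ne_top_of_le_ne_top one_ne_top hy)]

lemma isProbabilityMeasure_mixture {X : Type*} [MeasurableSpace X] {n : ℕ} {a : Fin n → ℝ}
    (ha : ∀ k, 0 ≤ a k) (hsum : ∑ k, a k = 1) (μ : Fin n → Measure X)
    [∀ k, IsProbabilityMeasure (μ k)] :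
    IsProbabilityMeasure (∑ k, ENNReal.ofReal (a k) • μ k) := by
  constructor
  simp only [Measure.coe_finsetSum, Finset.sum_apply, Measure.smul_apply, measure_univ,
    smul_eq_mul, mul_one]
  rw [← ENNReal.ofReal_sum_of_nonneg fun k _ => ha k, hsum, ENNReal.ofReal_one]

/-- The mixture bound for given families `P k`, where `P k` only needs to be a partition
for the components of nonzero weight. -/
lemma entropyH_mixture_le_partEntropy {X : Type*} [MeasurableSpace X] {n : ℕ} {a : Fin n → ℝ}
    (ha : ∀ k, a k ∈ Set.Icc (0 : ℝ) 1) (hsum : ∑ k, a k = 1) (μ : Fin n → Measure X)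
    [∀ k, IsProbabilityMeasure (μ k)] {Q : Set (Set X)} {P : Fin n → Set (Set X)}
    (hcount : ∀ k, (P k).Countable) (hmeas : ∀ k, ∀ s ∈ P k, MeasurableSet s)
    (hdisj : ∀ k, (P k).Pairwise Disjoint) (hcover : ∀ k, a k ≠ 0 → μ k (⋃₀ P k)ᶜ = 0)
    (hfiner : ∀ k, Finer (P k) Q) :
    entropyH (∑ k, ENNReal.ofReal (a k) • μ k) Q ≤
      ∑ k, ENNReal.ofReal (a k) * partEntropy (μ k) (P k) + ENNReal.ofReal (Real.logb 2 n) := by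
  have := isProbabilityMeasure_mixture (fun k => (ha k).1) hsum μ
  have (k : Fin n) : Countable (P k) := (hcount k).to_subtype
  have hU (k : Fin n) : MeasurableSet (⋃₀ P k) := MeasurableSet.sUnion (hcount k) (hmeas k)
  let m : (Σ k, P k) → Measure X := fun i => ENNReal.ofReal (a i.1) • (μ i.1).restrict i.2
  have hm (i : Σ k, P k) : m i (i.2 : Set X)ᶜ = 0 := by
    simp [m, Measure.restrict_apply (hmeas i.1 i.2 i.2.2).compl]
  have hrestrict (k : Fin n) (s : Set X) (hs : MeasurableSet s) :
      ∑' p : P k, (μ k).restrict (p : Set X) s = (μ k).restrict (⋃₀ P k) s := by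
    rw [Set.sUnion_eq_iUnion, Measure.restrict_iUnion
      (fun p q hpq => hdisj k p.2 q.2 fun h => hpq (Subtype.ext h)) (fun p => hmeas k p p.2),
      Measure.sum_apply _ hs]
  have hmsum : Measure.sum m = ∑ k, ENNReal.ofReal (a k) • μ k := by
    ext s hs
    rw [Measure.sum_apply _ hs, ENNReal.tsum_sigma', tsum_fintype]
    simp only [m, Measure.coe_finsetSum, Finset.sum_apply, Measure.smul_apply, smul_eq_mul]
    refine Finset.sum_congr rfl fun k _ => ?_
    rw [ENNReal.tsum_mul_left, hrestrict k s hs]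
    rcases eq_or_ne (a k) 0 with h | h
    · simp [h]
    · rw [Measure.restrict_eq_self_of_ae_mem]
      exact mem_ae_iff.2 (hcover k h)
  obtain ⟨R, hR, hRf, hRe⟩ := exists_isMuPartition_of_sum_eq
    (A := fun i : Σ k, P k => (i.2 : Set X)) (fun i => hmeas i.1 i.2 i.2.2) hm hmsum
  have hRQ : Finer R Q := by
    intro r hr
    obtain ⟨_, ⟨i, rfl⟩, hi⟩ := hRf r hr
    obtain ⟨q, hq, hiq⟩ := hfiner i.1 i.2 i.2.2
    exact ⟨q, hq, hi.trans hiq⟩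
  calc entropyH (∑ k, ENNReal.ofReal (a k) • μ k) Q
      ≤ partEntropy (∑ k, ENNReal.ofReal (a k) • μ k) R := iInf_le_of_le R (iInf₂_le hR hRQ)
    _ ≤ ∑' i, ENNReal.ofReal (sh (m i Set.univ).toReal) := hRe
    _ = ∑ k, ∑' p : P k, (ENNReal.ofReal (a k) * ENNReal.ofReal (sh (μ k p).toReal) +
          μ k p * ENNReal.ofReal (sh (a k))) := by
      rw [ENNReal.tsum_sigma', tsum_fintype]
      refine Finset.sum_congr rfl fun k _ => tsum_congr fun p => ?_
      rw [← ofReal_sh_mul (ha k) prob_le_one]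
      simp [m]
    _ ≤ ∑ k, (ENNReal.ofReal (a k) * partEntropy (μ k) (P k) + ENNReal.ofReal (sh (a k))) := by
      refine Finset.sum_le_sum fun k _ => ?_
      rw [ENNReal.tsum_add, ENNReal.tsum_mul_left, ENNReal.tsum_mul_right, partEntropy]
      gcongr
      refine mul_le_of_le_one_left (zero_le) ?_
      have h := hrestrict k Set.univ MeasurableSet.univ
      simp only [Measure.restrict_apply_univ] at h
      exact h ▸ prob_le_one
    _ ≤ _ := by
      rw [Finset.sum_add_distrib,
        ← ENNReal.ofReal_sum_of_nonneg fun k _ => sh_nonneg (ha k).1 (ha k).2]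
      gcongr
      exact sum_sh_le_logb (fun k => (ha k).1) hsum

/-- Approximation of a finite entropy by partitions. -/
lemma exists_partEntropy_lt_of_entropyH_lt {X : Type*} [MeasurableSpace X] {μ : Measure X}
    {Q : Set (Set X)} {t : ℝ≥0∞} (h : entropyH μ Q < t) :
    ∃ P, IsMuPartition μ P ∧ Finer P Q ∧ partEntropy μ P < t := by
  simpa only [entropyH, iInf_lt_iff, exists_prop] using h

/-- formula (26) of the paper:
`H(Σ_k a_k μ_k; Q) ≤ Σ_k a_k H(μ_k;Q) + log₂ n`. -/
theorem entropyH_mixture_le_log {X : Type*} [MeasurableSpace X]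
    (n : ℕ) (a : Fin n → ℝ) (ha : ∀ k, a k ∈ Set.Icc (0 : ℝ) 1) (hsum : ∑ k, a k = 1)
    (μ : Fin n → Measure X) (hμ : ∀ k, IsProbabilityMeasure (μ k))
    (Q : Set (Set X)) (hQ : ∀ q ∈ Q, MeasurableSet q) :
    entropyH (∑ k, ENNReal.ofReal (a k) • μ k) Q ≤
      ∑ k, ENNReal.ofReal (a k) * entropyH (μ k) Q + ENNReal.ofReal (Real.logb 2 n) := by
  by_cases htop : ∃ k, a k ≠ 0 ∧ entropyH (μ k) Q = ⊤
  · obtain ⟨k, hk, hkt⟩ := htop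
    have hak : ENNReal.ofReal (a k) ≠ 0 := (ENNReal.ofReal_pos.2 ((ha k).1.lt_of_ne' hk)).ne'
    have : ∑ k, ENNReal.ofReal (a k) * entropyH (μ k) Q = ⊤ :=
      ENNReal.sum_eq_top.2 ⟨k, Finset.mem_univ k, by rw [hkt, ENNReal.mul_top hak]⟩
    rw [this, top_add]
    exact le_top
  push Not at htop
  refine ENNReal.le_of_forall_pos_le_add fun ε hε _ => ?_
  have hex (k : Fin n) : ∃ P : Set (Set X), P.Countable ∧ (∀ s ∈ P, MeasurableSet s) ∧
      P.Pairwise Disjoint ∧ (a k ≠ 0 → μ k (⋃₀ P)ᶜ = 0) ∧ Finer P Q ∧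
      partEntropy (μ k) P ≤ entropyH (μ k) Q + ε := by
    rcases eq_or_ne (a k) 0 with h | h
    · exact ⟨∅, Set.countable_empty, by simp, by simp, by simp [h], by simp [Finer],
        by simp [partEntropy]⟩
    · obtain ⟨P, ⟨h1, h2, h3, h4⟩, hf, hlt⟩ := exists_partEntropy_lt_of_entropyH_lt
        (ENNReal.lt_add_right (htop k h) (ENNReal.coe_pos.2 hε).ne')
      exact ⟨P, h1, h2, h3, fun _ => h4, hf, hlt.le⟩
  choose P hcount hmeas hdisj hcover hfiner hent using hex
  calc entropyH (∑ k, ENNReal.ofReal (a k) • μ k) Q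
      ≤ ∑ k, ENNReal.ofReal (a k) * partEntropy (μ k) (P k) + ENNReal.ofReal (Real.logb 2 n) :=
        entropyH_mixture_le_partEntropy ha hsum μ hcount hmeas hdisj hcover hfiner
    _ ≤ ∑ k, ENNReal.ofReal (a k) * (entropyH (μ k) Q + ε) + ENNReal.ofReal (Real.logb 2 n) := by
      gcongr with k
      exact hent k
    _ = _ := by
      simp only [mul_add, Finset.sum_add_distrib]
      rw [← Finset.sum_mul, ← ENNReal.ofReal_sum_of_nonneg fun k _ => (ha k).1, hsum,
        ENNReal.ofReal_one, one_mul, add_right_comm]
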